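/- Let V ⊂ Z^N be a positive circular subset such that: v·v ≤ -2 for each v ∈ V; Λ_V ⊂ Z^N has finite and odd index; the Wu element W = ∑_{v∈V} v satisfies W·W = -N; the coefficient map with respect to an adapted canonical basis is not injective; and ∑_{v∈D}(v·v+2) = -|D| for each connected component D of V. Then there is a connected component C of V whose string of self-intersections is obtained, up to circular symmetry (cyclic rotation and reversal), from (-2,-2,-5) by a finite sequence of (-2)-expansions. -/

import Mathlib

open Finset

/-- The standard negative definite bilinear form on `ℤ^N`:
`x·y = -∑ i, x i * y i`. -/
def negForm (N : ℕ) (u v : Fin N → ℤ) : ℤ := -∑ i, u i * v i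

/-- A canonical basis of `ℤ^N`: a set of `N` vectors with `e·e = -1` and
distinct elements pairwise orthogonal. -/
def IsCanonicalBasis (N : ℕ) (E : Finset (Fin N → ℤ)) : Prop :=
  E.card = N ∧ (∀ e ∈ E, negForm N e e = -1) ∧
    ∀ e ∈ E, ∀ f ∈ E, e ≠ f → negForm N e f = 0

/-- The equivalence relation on `ℤ^N` generated by `u ~ v` iff
`u, v ∈ V` and `u·v ≠ 0`. -/
def Conn (N : ℕ) (V : Finset (Fin N → ℤ)) : (Fin N → ℤ) → (Fin N → ℤ) → Prop :=
  Relation.EqvGen fun u v => u ∈ V ∧ v ∈ V ∧ negForm N u v ≠ 0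

open scoped Classical in
/-- The connected component of `v` in `V`. -/
noncomputable def compOf (N : ℕ) (V : Finset (Fin N → ℤ)) (v : Fin N → ℤ) :
    Finset (Fin N → ℤ) :=
  V.filter fun u => Conn N V u v

/-- A circular subset of `ℤ^N`. -/
def IsCircular (N : ℕ) (V : Finset (Fin N → ℤ)) : Prop :=
  (∀ v ∈ V, 3 ≤ (compOf N V v).card) ∧
  (∀ u ∈ V, ∀ v ∈ V, u ≠ v →
    negForm N u v = -1 ∨ negForm N u v = 0 ∨ negForm N u v = 1) ∧
  (∀ v ∈ V,
    (V.filter fun u => u ≠ v ∧ (negForm N u v = 1 ∨ negForm N u v = -1)).card = 2)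

/-- `E` is a canonical basis adapted to `V`:  `∑_{v ∈ V} v = -∑_{e ∈ E} e`. -/
def IsAdaptedBasis (N : ℕ) (E V : Finset (Fin N → ℤ)) : Prop :=
  IsCanonicalBasis N E ∧ (∑ v ∈ V, v) = -∑ e ∈ E, e

open scoped Classical in
/-- A semipositive circular subset: each connected component contains exactly one
(unordered) pair of distinct vectors `u, v` with `u·v = -1`. -/
def IsSemipositive (N : ℕ) (V : Finset (Fin N → ℤ)) : Prop :=
  IsCircular N V ∧ ∀ v₀ ∈ V,
    (((compOf N V v₀) ×ˢ (compOf N V v₀)).filter fun p =>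
      p.1 ≠ p.2 ∧ negForm N p.1 p.2 = -1).card = 2

/-- A positive circular subset: `u·v ≥ 0` for all distinct `u, v ∈ V`. -/
def IsPositive (N : ℕ) (V : Finset (Fin N → ℤ)) : Prop :=
  IsCircular N V ∧ ∀ u ∈ V, ∀ v ∈ V, u ≠ v → 0 ≤ negForm N u v

/-- A single blowup of a string of nonnegative integers. -/
inductive IsBlowup : List ℕ → List ℕ → Prop
  | left (a b : ℕ) (m : List ℕ) :
      IsBlowup (a :: (m ++ [b])) (1 :: (a + 1) :: (m ++ [b + 1]))
  | middle (a b : ℕ) (p s : List ℕ) :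
      IsBlowup (p ++ a :: b :: s) (p ++ (a + 1) :: 1 :: (b + 1) :: s)
  | right (a b : ℕ) (m : List ℕ) :
      IsBlowup (a :: (m ++ [b])) ((a + 1) :: (m ++ [b + 1, 1]))

/-- An iterated blowup of `(0,0)`. -/
def IsIteratedBlowup (s : List ℕ) : Prop :=
  Relation.ReflTransGen IsBlowup [0, 0] s

/-- A `(-2)`-expansion of a string of negative integers. -/
inductive IsNeg2Expansion : List ℤ → List ℤ → Prop
  | first (l : List ℤ) (a : ℤ) :
      IsNeg2Expansion (-2 :: (l ++ [a])) (-2 :: -2 :: (l ++ [a - 1]))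
  | second (a : ℤ) (l : List ℤ) :
      IsNeg2Expansion (-2 :: a :: l) (-2 :: (a - 1) :: (l ++ [-2]))

/-- A cyclic listing of (the elements of) a connected component `C` of a circular
subset: a cyclically indexed enumeration of `C` in which consecutive elements
pair to `±1`. -/
def IsCyclicListing (N : ℕ) (C : Finset (Fin N → ℤ)) (m : ℕ)
    (w : ZMod m → (Fin N → ℤ)) : Prop :=
  C.card = m ∧ Function.Injective w ∧ (∀ i, w i ∈ C) ∧ (∀ c ∈ C, ∃ i, w i = c) ∧
    ∀ i : ZMod m, negForm N (w i) (w (i + 1)) = 1 ∨ negForm N (w i) (w (i + 1)) = -1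

/-- The index in the cyclic string at which the `i`-th block starts. -/
def blockStart {t : ℕ} (y : Fin t → ℕ) (i : Fin t) : ℕ := ∑ i' ∈ Finset.Iio i, y i'

/-- The string of squares `(-x₁-2, -2,…,-2, …, -xₜ-2, -2,…,-2)` of the lattice
`Λ_Γ`, as a function on `Fin n` (where `n = ∑ yᵢ`). -/
def sqOf {t : ℕ} (x y : Fin t → ℕ) (n : ℕ) (j : Fin n) : ℤ :=
  -2 - ∑ i : Fin t, if (j : ℕ) = blockStart y i then (x i : ℤ) else 0

/-- The Gram matrix of the lattice `Λ_Γ`: diagonal given by `sq`, consecutive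
vertices pair to `1`, the last and first vertices pair to `(-1)^d`, all other
pairs are orthogonal. -/
def gramOf (n : ℕ) (sq : Fin n → ℤ) (d : ℕ) (i j : Fin n) : ℤ :=
  if i = j then sq i
  else if (j : ℕ) = (i : ℕ) + 1 ∨ (i : ℕ) = (j : ℕ) + 1 then 1
  else if ((i : ℕ) = 0 ∧ (j : ℕ) = n - 1) ∨ ((j : ℕ) = 0 ∧ (i : ℕ) = n - 1)
    then (-1) ^ d
  else 0

theorem sum_sum_mul_eq_sum_sq_sub {κ : Type*} [Fintype κ] (g : κ → κ → ℚ)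
    (hg : ∀ i j, g i j = g j i) (x : κ → ℚ) :
    ∑ i, ∑ j, x i * x j * g i j =
      ∑ i, x i ^ 2 * ∑ j, g i j - 1 / 2 * ∑ i, ∑ j, g i j * (x i - x j) ^ 2 := by
  have h1 : ∑ i, ∑ j, g i j * x j ^ 2 = ∑ i, ∑ j, g i j * x i ^ 2 := by
    rw [Finset.sum_comm]
    simp only [hg]
  have h2 : ∑ i, ∑ j, g i j * (x i - x j) ^ 2 =
      ∑ i, ∑ j, g i j * x i ^ 2 + ∑ i, ∑ j, g i j * x j ^ 2
        - 2 * ∑ i, ∑ j, x i * x j * g i j := by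
    simp only [Finset.mul_sum, ← Finset.sum_add_distrib, ← Finset.sum_sub_distrib]
    refine Finset.sum_congr rfl fun i _ => Finset.sum_congr rfl fun j _ => ?_
    ring
  have h3 : ∑ i, x i ^ 2 * ∑ j, g i j = ∑ i, ∑ j, g i j * x i ^ 2 := by
    simp only [Finset.mul_sum]
    simp only [mul_comm]
  rw [h2, h1, h3]
  ring

/-- A finite family of integral vectors with nonpositive mutual products and nonnegative row sums
of the Gram matrix is linearly independent if every connected component of its Gram graph
contains a vector with positive row sum. -/
theorem linearIndependent_of_gram {κ ι : Type*} [Fintype κ] [Fintype ι] (v : κ → ι → ℤ)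
    (hoff : ∀ i j, i ≠ j → v i ⬝ᵥ v j ≤ 0) (hrow : ∀ i, 0 ≤ ∑ j, v i ⬝ᵥ v j)
    (hconn : ∀ i, ∃ j, Relation.EqvGen (fun a b => v a ⬝ᵥ v b ≠ 0) i j ∧
      0 < ∑ l, v j ⬝ᵥ v l) :
    LinearIndependent ℚ (fun k i => (v k i : ℚ)) := by
  rw [Fintype.linearIndependent_iff]
  intro x hx
  set g : κ → κ → ℚ := fun i j => ((v i ⬝ᵥ v j : ℤ) : ℚ) with hg
  have hsymm : ∀ i j, g i j = g j i := fun i j => by simp only [hg, dotProduct_comm]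
  have hzero : ∑ i, ∑ j, x i * x j * g i j = 0 := by
    have : ∑ i, ∑ j, x i * x j * g i j =
        (∑ k, x k • fun i => (v k i : ℚ)) ⬝ᵥ (∑ k, x k • fun i => (v k i : ℚ)) := by
      rw [sum_dotProduct]
      refine Finset.sum_congr rfl fun i _ => ?_
      rw [dotProduct_sum]
      refine Finset.sum_congr rfl fun j _ => ?_
      rw [smul_dotProduct, dotProduct_smul]
      simp [hg, dotProduct, mul_assoc]
    rw [this, hx, zero_dotProduct]
  rw [sum_sum_mul_eq_sum_sq_sub g hsymm] at hzero
  have hrow' : ∀ i, (0 : ℚ) ≤ ∑ j, g i j := fun i => by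
    simp only [hg]
    exact_mod_cast hrow i
  have hA : ∀ i ∈ Finset.univ, 0 ≤ x i ^ 2 * ∑ j, g i j :=
    fun i _ => mul_nonneg (sq_nonneg _) (hrow' i)
  have hB' : ∀ i j, g i j * (x i - x j) ^ 2 ≤ 0 := by
    intro i j
    by_cases hij : i = j
    · simp [hij]
    · exact mul_nonpos_of_nonpos_of_nonneg (by simp only [hg]; exact_mod_cast hoff i j hij) (sq_nonneg _)
  have hB : ∀ i ∈ Finset.univ, ∑ j, g i j * (x i - x j) ^ 2 ≤ 0 :=
    fun i _ => Finset.sum_nonpos fun j _ => hB' i j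
  have hA0 : ∑ i, x i ^ 2 * ∑ j, g i j = 0 := by
    linarith [Finset.sum_nonneg hA, Finset.sum_nonpos hB]
  have hB0 : ∑ i, ∑ j, g i j * (x i - x j) ^ 2 = 0 := by
    linarith [Finset.sum_nonneg hA, Finset.sum_nonpos hB]
  have hedge : ∀ i j, v i ⬝ᵥ v j ≠ 0 → x i = x j := by
    intro i j hij
    have h1 := (Finset.sum_eq_zero_iff_of_nonpos hB).1 hB0 i (Finset.mem_univ _)
    have h2 := (Finset.sum_eq_zero_iff_of_nonpos fun j _ => hB' i j).1 h1 j (Finset.mem_univ _)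
    have h3 : g i j ≠ 0 := by simp only [hg]; exact_mod_cast hij
    have h4 := pow_eq_zero_iff two_ne_zero |>.1 ((mul_eq_zero.1 h2).resolve_left h3)
    linarith
  intro i
  obtain ⟨j, hij, hj⟩ := hconn i
  have hxij : x i = x j := by
    clear hj
    induction hij with
    | rel a b h => exact hedge a b h
    | refl a => rfl
    | symm a b _ h => exact h.symm
    | trans a b c _ _ h1 h2 => exact h1.trans h2
  have h1 := (Finset.sum_eq_zero_iff_of_nonneg hA).1 hA0 j (Finset.mem_univ _)
  have h2 : (∑ l, g j l) ≠ 0 := by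
    have : (0 : ℚ) < ∑ l, g j l := by simp only [hg]; exact_mod_cast hj
    exact this.ne'
  rw [hxij]
  exact pow_eq_zero_iff two_ne_zero |>.1 ((mul_eq_zero.1 h1).resolve_right h2)

/-- The products of `c 0, …, c (m - 1)` are those of a cycle: cyclically consecutive vectors
have product `-1` (with multiplicity when `m = 2`) and the other pairs are orthogonal. -/
def CycGram {ι : Type*} [Fintype ι] (m : ℕ) (c : ℕ → ι → ℤ) : Prop :=
  ∀ i < m, ∀ j < m, c i ⬝ᵥ c j = (if i = j then c i ⬝ᵥ c i else 0)
    - (if j = i + 1 then 1 else 0) - (if i = j + 1 then 1 else 0)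
    - (if i = 0 ∧ j + 1 = m then 1 else 0) - (if j = 0 ∧ i + 1 = m then 1 else 0)

section CycGram

variable {ι : Type*} [Fintype ι]

theorem CycGram.sum_dotProduct {m : ℕ} {c : ℕ → ι → ℤ} (hc : CycGram m c) (hm : 2 ≤ m)
    {i : ℕ} (hi : i < m) : ∑ j : Fin m, c i ⬝ᵥ c j = c i ⬝ᵥ c i - 2 := by
  have hcoef : ∀ (p : ℕ → Prop) [DecidablePred p] (a : ℕ) (x : ℤ), (∀ j < m, p j ↔ j = a) →
      ∑ j ∈ Finset.range m, (if p j then x else 0) = if a < m then x else 0 := by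
    intro p _ a x hp
    rw [Finset.sum_congr rfl (g := fun j => if j = a then x else 0)
      (fun j hj => by simp only [hp j (Finset.mem_range.1 hj)])]
    simp
  have hnone : ∀ (p : ℕ → Prop) [DecidablePred p] (x : ℤ), (∀ j < m, ¬ p j) →
      ∑ j ∈ Finset.range m, (if p j then x else 0) = 0 := by
    intro p _ x hp
    exact Finset.sum_eq_zero fun j hj => if_neg (hp j (Finset.mem_range.1 hj))
  rw [Fin.sum_univ_eq_sum_range (fun j => c i ⬝ᵥ c j) m,
    Finset.sum_congr rfl fun j hj => hc i hi j (Finset.mem_range.1 hj)]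
  simp only [Finset.sum_sub_distrib]
  rw [hcoef (fun j => i = j) i _ (by omega), hcoef (fun j => j = i + 1) (i + 1) _ (by omega)]
  rcases Nat.eq_zero_or_pos i with h0 | h0
  · rw [hnone (fun j => i = j + 1) _ (by omega),
      hcoef (fun j => i = 0 ∧ j + 1 = m) (m - 1) _ (by omega),
      hnone (fun j => j = 0 ∧ i + 1 = m) _ (by omega)]
    rw [if_pos hi, if_pos (by omega), if_pos (by omega)]
    ring
  · rw [hcoef (fun j => i = j + 1) (i - 1) _ (by omega),
      hnone (fun j => i = 0 ∧ j + 1 = m) _ (by omega), if_pos hi, if_pos (show i - 1 < m by omega)]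
    by_cases h1 : i + 1 = m
    · rw [hcoef (fun j => j = 0 ∧ i + 1 = m) 0 _ (by omega), if_neg (by omega),
        if_pos (by omega)]
      ring
    · rw [hnone (fun j => j = 0 ∧ i + 1 = m) _ (by omega), if_pos (by omega)]
      ring

theorem CycGram.le_finrank {m : ℕ} {c : ℕ → ι → ℤ} (hc : CycGram m c) (hm : 2 ≤ m)
    (h2 : ∀ i < m, 2 ≤ c i ⬝ᵥ c i) (h3 : ∃ i < m, 2 < c i ⬝ᵥ c i)
    (S : Submodule ℚ (ι → ℚ)) (hS : ∀ i < m, (fun x => (c i x : ℚ)) ∈ S) :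
    m ≤ Module.finrank ℚ S := by
  have hli : LinearIndependent ℚ (fun (k : Fin m) i => (c k i : ℚ)) := by
    refine linearIndependent_of_gram (fun k : Fin m => c k) ?_ ?_ ?_
    · intro i j hij
      have hij' : (i : ℕ) ≠ j := fun h => hij (Fin.ext h)
      simp only [hc i i.2 j j.2]
      rw [if_neg hij']
      split_ifs <;> norm_num
    · intro i
      simp only [hc.sum_dotProduct hm i.2]
      linarith [h2 i i.2]
    · intro i
      obtain ⟨j, hj, hj2⟩ := h3
      refine ⟨⟨j, hj⟩, ?_, by simp only [hc.sum_dotProduct hm hj]; linarith⟩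
      have key : ∀ n (hn : n < m),
          Relation.EqvGen (fun a b : Fin m => c a ⬝ᵥ c b ≠ 0) ⟨0, by omega⟩ ⟨n, hn⟩ := by
        intro n
        induction n with
        | zero => exact fun _ => Relation.EqvGen.refl _
        | succ n ih =>
          intro hn
          refine (ih (by omega)).trans _ _ _ (Relation.EqvGen.rel _ _ ?_)
          simp only [hc n (by omega) (n + 1) hn]
          split_ifs <;> omega
      exact ((key i i.2).symm _ _).trans _ _ _ (key j hj)
  have hli' : LinearIndependent ℚ (fun k : Fin m => (⟨_, hS k k.2⟩ : S)) :=
    LinearIndependent.of_comp S.subtype hli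
  simpa using hli'.fintype_card_le_finrank

end CycGram

section Contraction

variable {ι : Type*} [Fintype ι] [DecidableEq ι]

theorem update_zero_dotProduct (x y : ι → ℤ) (e : ι) :
    Function.update x e 0 ⬝ᵥ y = x ⬝ᵥ y - x e * y e := by
  have : Function.update x e 0 = x - Pi.single e (x e) := by
    ext i
    by_cases h : i = e
    · subst h; simp
    · simp [h]
  rw [this, sub_dotProduct, single_dotProduct]

theorem update_zero_dotProduct_update_zero (x y : ι → ℤ) (e : ι) :
    Function.update x e 0 ⬝ᵥ Function.update y e 0 = x ⬝ᵥ y - x e * y e := by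
  rw [update_zero_dotProduct, Function.update_self, mul_zero, sub_zero, dotProduct_comm,
    update_zero_dotProduct, dotProduct_comm, mul_comm]

theorem exists_eq_zero_of_dotProduct_self_eq_two {v : ι → ℤ} {e : ι} (hv : v ⬝ᵥ v = 2)
    (he : v e ^ 2 = 1) :
    ∃ f ≠ e, v f ^ 2 = 1 ∧ ∀ i, i ≠ e → i ≠ f → v i = 0 := by
  have h1 : ∑ i ∈ Finset.univ.erase e, v i * v i = 1 := by
    have := Finset.add_sum_erase Finset.univ (fun i => v i * v i) (Finset.mem_univ e)
    simp only [dotProduct] at hv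
    rw [hv] at this
    nlinarith
  obtain ⟨f, hf, hf0⟩ := Finset.exists_ne_zero_of_sum_ne_zero (h1.symm ▸ one_ne_zero)
  have hfe := (Finset.mem_erase.1 hf).1
  have h2 := Finset.add_sum_erase (Finset.univ.erase e) (fun i => v i * v i) hf
  have h3 : ∀ i ∈ (Finset.univ.erase e).erase f, 0 ≤ v i * v i := fun i _ => mul_self_nonneg _
  have h4 := Finset.sum_nonneg h3
  have h5 : 0 < v f * v f := lt_of_le_of_ne (mul_self_nonneg _) hf0.symm
  have h6 : ∑ i ∈ (Finset.univ.erase e).erase f, v i * v i = 0 := by linarith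
  refine ⟨f, hfe, by nlinarith, fun i hi hif => ?_⟩
  have := (Finset.sum_eq_zero_iff_of_nonneg h3).1 h6 i (by simp [hi, hif])
  exact mul_self_eq_zero.1 this

theorem finrank_inf_ker_proj_lt {S : Submodule ℚ (ι → ℚ)} {e : ι}
    (he : (Pi.single e 1 : ι → ℚ) ∈ S) :
    Module.finrank ℚ ↥(S ⊓ LinearMap.ker (LinearMap.proj e : (ι → ℚ) →ₗ[ℚ] ℚ)) <
      Module.finrank ℚ S := by
  refine Submodule.finrank_lt_finrank_of_lt (lt_of_le_of_ne inf_le_left fun h => ?_)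
  have : (Pi.single e 1 : ι → ℚ) ∈ S ⊓ LinearMap.ker (LinearMap.proj e) := h.symm ▸ he
  simp at this

omit [Fintype ι] in
theorem cast_update_zero_mem {S : Submodule ℚ (ι → ℚ)} {e : ι}
    (he : (Pi.single e 1 : ι → ℚ) ∈ S) {v : ι → ℤ} (hv : (fun i => (v i : ℚ)) ∈ S) :
    (fun i => ((Function.update v e 0 i : ℤ) : ℚ)) ∈
      S ⊓ LinearMap.ker (LinearMap.proj e : (ι → ℚ) →ₗ[ℚ] ℚ) := by
  refine ⟨?_, by simp⟩
  have : (fun i => ((Function.update v e 0 i : ℤ) : ℚ)) =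
      (fun i => (v i : ℚ)) - (v e : ℚ) • Pi.single e 1 := by
    ext i
    by_cases h : i = e
    · subst h; simp
    · simp [h]
  rw [this]
  exact S.sub_mem hv (S.smul_mem _ he)

/-- A cycle of vectors of square at least `2` spanning a space of maximal dimension inside `S`,
whose first vector is the only one involving the coordinate `e ∈ S`. -/
structure CycData (m : ℕ) (c : ℕ → ι → ℤ) (S : Submodule ℚ (ι → ℚ)) (e : ι) : Prop where
  gram : CycGram m c
  two_le : ∀ i < m, 2 ≤ c i ⬝ᵥ c i
  sum_eq : ∑ i ∈ Finset.range m, (c i ⬝ᵥ c i - 2) = m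
  finrank_le : Module.finrank ℚ S ≤ m
  mem : ∀ i < m, (fun x => (c i x : ℚ)) ∈ S
  single_mem : (Pi.single e 1 : ι → ℚ) ∈ S
  sq_eq_one : c 0 e ^ 2 = 1
  eq_zero : ∀ i, 0 < i → i < m → c i e = 0

theorem CycData.dotProduct_self_zero {m : ℕ} {c : ℕ → ι → ℤ} {S : Submodule ℚ (ι → ℚ)} {e : ι}
    (h : CycData m c S e) (hm : 3 ≤ m) : c 0 ⬝ᵥ c 0 = 2 := by
  by_contra hne
  have h0 : 3 ≤ c 0 ⬝ᵥ c 0 := by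
    have := h.two_le 0 (by omega)
    omega
  set c' : ℕ → ι → ℤ := fun i => Function.update (c i) e 0 with hc'
  have hmul : ∀ i < m, ∀ j < m, c i e * c j e = if i = 0 ∧ j = 0 then 1 else 0 := by
    intro i hi j hj
    split_ifs with hij
    · rw [hij.1, hij.2, ← sq, h.sq_eq_one]
    · rcases Nat.eq_zero_or_pos i with hi0 | hi0
      · rw [h.eq_zero j (by omega) hj, mul_zero]
      · rw [h.eq_zero i hi0 hi, zero_mul]
  have hdot : ∀ i < m, ∀ j < m, c' i ⬝ᵥ c' j = c i ⬝ᵥ c j - if i = 0 ∧ j = 0 then 1 else 0 := by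
    intro i hi j hj
    rw [update_zero_dotProduct_update_zero, hmul i hi j hj]
  have hgram : CycGram m c' := by
    intro i hi j hj
    rw [hdot i hi j hj, hdot i hi i hi, h.gram i hi j hj]
    split_ifs <;> omega
  have htwo : ∀ i < m, 2 ≤ c' i ⬝ᵥ c' i := by
    intro i hi
    rw [hdot i hi i hi]
    have := h.two_le i hi
    split_ifs with hi0
    · rw [hi0.1]; omega
    · omega
  have hex : ∃ i < m, 2 < c' i ⬝ᵥ c' i := by
    by_contra! hcon
    have hle : ∑ i ∈ Finset.range m, (c i ⬝ᵥ c i - 2) ≤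
        ∑ i ∈ Finset.range m, if i = 0 then 1 else 0 := by
      refine Finset.sum_le_sum fun i hi => ?_
      have h1 := hcon i (Finset.mem_range.1 hi)
      rw [hdot i (Finset.mem_range.1 hi) i (Finset.mem_range.1 hi)] at h1
      simp only [and_self] at h1
      linarith
    rw [h.sum_eq, Finset.sum_ite_eq' (Finset.range m) 0] at hle
    split_ifs at hle <;> omega
  have hle := hgram.le_finrank (by omega) htwo hex _
    fun i hi => cast_update_zero_mem h.single_mem (h.mem i hi)
  have hlt := finrank_inf_ker_proj_lt h.single_mem
  have := h.finrank_le
  omega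

theorem CycData.exists_second_coordinate {m : ℕ} {c : ℕ → ι → ℤ} {S : Submodule ℚ (ι → ℚ)}
    {e : ι} (h : CycData m c S e) (hm : 3 ≤ m) :
    ∃ f ≠ e, (Pi.single f 1 : ι → ℚ) ∈
        S ⊓ LinearMap.ker (LinearMap.proj e : (ι → ℚ) →ₗ[ℚ] ℚ) ∧ c 0 f ^ 2 = 1 ∧
      ∀ i, 0 < i → i < m → c i f = -c 0 f * ((if i = 1 then 1 else 0) +
        (if i + 1 = m then 1 else 0)) := by
  obtain ⟨f, hfe, hf, hz⟩ :=
    exists_eq_zero_of_dotProduct_self_eq_two (h.dotProduct_self_zero hm) h.sq_eq_one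
  refine ⟨f, hfe, ⟨?_, by simp [hfe.symm]⟩, hf, ?_⟩
  · have h1 : (Pi.single f 1 : ι → ℚ) = (c 0 f : ℚ) • ((fun x => (c 0 x : ℚ))
        - (c 0 e : ℚ) • Pi.single e 1) := by
      ext i
      by_cases hif : i = f
      · subst hif
        simp [hfe, ← sq]
        exact_mod_cast hf.symm
      · by_cases hie : i = e
        · subst hie; simp [hif]
        · simp [hif, hie, hz i hie hif]
    rw [h1]
    exact S.smul_mem _ (S.sub_mem (h.mem 0 (by omega)) (S.smul_mem _ h.single_mem))
  · intro i hi0 him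
    have h1 : c i ⬝ᵥ c 0 = c i f * c 0 f := by
      rw [dotProduct, Finset.sum_eq_single f]
      · intro j _ hj
        by_cases hje : j = e
        · rw [hje, h.eq_zero i hi0 him, zero_mul]
        · rw [hz j hje hj, mul_zero]
      · simp
    have h2 : c i f = c 0 f * (c i ⬝ᵥ c 0) := by
      rw [h1]
      linear_combination -c i f * hf
    rw [h2, h.gram i him 0 (by omega)]
    have e1 : ¬ i = 0 := by omega
    have e2 : ¬ 0 = i + 1 := by omega
    simp [e1]
    ring

theorem CycData.dotProduct_self_one_or {m : ℕ} {c : ℕ → ι → ℤ} {S : Submodule ℚ (ι → ℚ)}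
    {e : ι} (h : CycData (m + 1) c S e) (hm : 2 ≤ m) :
    c 1 ⬝ᵥ c 1 = 2 ∨ c m ⬝ᵥ c m = 2 := by
  by_contra! hne
  have h1 : 3 ≤ c 1 ⬝ᵥ c 1 := by
    have := h.two_le 1 (by omega)
    omega
  have h2 : 3 ≤ c m ⬝ᵥ c m := by
    have := h.two_le m (by omega)
    omega
  obtain ⟨f, hfe, hfS, hf, hcf⟩ := h.exists_second_coordinate (by omega)
  set c' : ℕ → ι → ℤ := fun i => Function.update (c (i + 1)) f 0 with hc'
  have hdot : ∀ i < m, ∀ j < m, c' i ⬝ᵥ c' j = c (i + 1) ⬝ᵥ c (j + 1)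
      - ((if i = 0 then 1 else 0) + (if i + 1 = m then 1 else 0))
      * ((if j = 0 then 1 else 0) + (if j + 1 = m then 1 else 0)) := by
    intro i hi j hj
    rw [update_zero_dotProduct_update_zero, hcf (i + 1) (by omega) (by omega),
      hcf (j + 1) (by omega) (by omega)]
    simp only [Nat.add_eq_right, Nat.add_right_cancel_iff]
    linear_combination -((if i = 0 then (1 : ℤ) else 0) + (if i + 1 = m then 1 else 0))
      * ((if j = 0 then 1 else 0) + (if j + 1 = m then 1 else 0)) * hf
  have hgram : CycGram m c' := by
    intro i hi j hj
    rw [hdot i hi j hj, hdot i hi i hi, h.gram (i + 1) (by omega) (j + 1) (by omega)]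
    simp only [Nat.add_right_cancel_iff, Nat.add_eq_zero_iff, one_ne_zero, and_false, false_and,
      if_false, sub_zero]
    generalize c (i + 1) ⬝ᵥ c (i + 1) = a
    clear * - hi hj hm
    by_cases hij : i = j
    · subst hij
      simp only [if_true]
      split_ifs <;> omega
    · simp only [hij, if_false]
      by_cases hi0 : i = 0 <;> by_cases him : i + 1 = m <;> by_cases hj0 : j = 0 <;>
        by_cases hjm : j + 1 = m <;> simp [hi0, him, hj0, hjm] <;> omega
  have htwo : ∀ i < m, 2 ≤ c' i ⬝ᵥ c' i := by
    intro i hi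
    rw [hdot i hi i hi]
    have := h.two_le (i + 1) (by omega)
    split_ifs with hi0 hi1 hi1
    · omega
    · subst hi0; simp at *; omega
    · subst hi1; omega
    · omega
  have hex : ∃ i < m, 2 < c' i ⬝ᵥ c' i := by
    by_contra! hcon
    have hle : ∑ i ∈ Finset.range m, (c (i + 1) ⬝ᵥ c (i + 1) - 2) ≤
        ∑ i ∈ Finset.range m, ((if i = 0 then 1 else 0) + if i = m - 1 then 1 else 0) := by
      refine Finset.sum_le_sum fun i hi => ?_
      have hi' := Finset.mem_range.1 hi
      have h3 := hcon i hi'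
      rw [hdot i hi' i hi'] at h3
      split_ifs at h3 ⊢ <;> omega
    have hsum := h.sum_eq
    rw [Finset.sum_range_succ', h.dotProduct_self_zero (by omega)] at hsum
    rw [Finset.sum_add_distrib, Finset.sum_ite_eq', Finset.sum_ite_eq'] at hle
    push_cast at hsum
    split_ifs at hle <;> omega
  have hle := hgram.le_finrank hm htwo hex _
    fun i hi => cast_update_zero_mem hfS ⟨h.mem (i + 1) (by omega), by
      simp [h.eq_zero (i + 1) (by omega) (by omega)]⟩
  have hlt := finrank_inf_ker_proj_lt h.single_mem
  have hlt' := finrank_inf_ker_proj_lt hfS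
  have := h.finrank_le
  omega

/-- Removing the first vector of a cycle of length at least four whose second vector has
square `2`. -/
theorem CycData.exists_contraction {k : ℕ} {c : ℕ → ι → ℤ} {S : Submodule ℚ (ι → ℚ)}
    {e : ι} (h : CycData (k + 4) c S e) (h1 : c 1 ⬝ᵥ c 1 = 2) :
    ∃ c' S' f, CycData (k + 3) c' S' f ∧ (∀ i < k + 2, c' i = c (i + 1)) ∧
      c' (k + 2) ⬝ᵥ c' (k + 2) = c (k + 3) ⬝ᵥ c (k + 3) - 1 := by
  obtain ⟨f, hfe, hfS, hf, hcf⟩ := h.exists_second_coordinate (by omega)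
  set c' : ℕ → ι → ℤ := fun i => if i = k + 2 then Function.update (c (i + 1)) f 0
    else c (i + 1) with hc'
  have hlow : ∀ i, i ≠ k + 2 → c' i = c (i + 1) := fun i hi => if_neg hi
  have hlast : c' (k + 2) = Function.update (c (k + 3)) f 0 := if_pos rfl
  have hcl : c (k + 3) f = - c 0 f := by
    rw [hcf (k + 3) (by omega) (by omega)]
    simp
  have hdot : ∀ i < k + 3, ∀ j < k + 3, c' i ⬝ᵥ c' j = c (i + 1) ⬝ᵥ c (j + 1)
      - (if i = k + 2 ∧ j = k + 2 then 1 else 0) - (if i = 0 ∧ j = k + 2 then 1 else 0)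
      - (if i = k + 2 ∧ j = 0 then 1 else 0) := by
    intro i hi j hj
    by_cases hi2 : i = k + 2
    · subst hi2
      rw [hlast]
      by_cases hj2 : j = k + 2
      · subst hj2
        rw [hlast, update_zero_dotProduct_update_zero, hcl]
        simp
        linear_combination hf
      · rw [hlow j hj2, update_zero_dotProduct, hcl, hcf (j + 1) (by omega) (by omega)]
        simp [hj2]
        split_ifs
        · linear_combination hf
        · ring
    · rw [hlow i hi2]
      by_cases hj2 : j = k + 2
      · subst hj2
        rw [hlast, dotProduct_comm, update_zero_dotProduct, hcl,
          hcf (i + 1) (by omega) (by omega), dotProduct_comm]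
        simp [hi2]
        split_ifs
        · linear_combination hf
        · ring
      · rw [hlow j hj2]
        simp [hi2, hj2]
  have hself : c' (k + 2) ⬝ᵥ c' (k + 2) = c (k + 3) ⬝ᵥ c (k + 3) - 1 := by
    rw [hdot (k + 2) (by omega) (k + 2) (by omega)]
    simp
  have hsum := h.sum_eq
  rw [Finset.sum_range_succ', h.dotProduct_self_zero (by omega), Finset.sum_range_succ] at hsum
  have hge : 3 ≤ c (k + 3) ⬝ᵥ c (k + 3) := by
    by_contra hcon
    have h2 : c (k + 3) ⬝ᵥ c (k + 3) = 2 := by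
      have := h.two_le (k + 3) (by omega)
      omega
    have hc1 : c 1 f = -c 0 f := by
      rw [hcf 1 (by omega) (by omega)]
      simp
    have h3 : c 1 ⬝ᵥ c (k + 3) = 0 := by
      rw [h.gram 1 (by omega) (k + 3) (by omega)]
      simp
    have h4 : Function.update (c 1 + c (k + 3)) f 0 = 0 := by
      rw [← dotProduct_self_eq_zero, update_zero_dotProduct_update_zero, add_dotProduct,
        dotProduct_add, dotProduct_add, dotProduct_comm (c (k + 3)) (c 1), h1, h2, h3,
        Pi.add_apply, hc1, hcl]
      linear_combination -4 * hf
    have h5 := update_zero_dotProduct (c 1 + c (k + 3)) (c 2) f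
    rw [h4, zero_dotProduct, hcf 2 (by omega) (by omega), add_dotProduct,
      h.gram 1 (by omega) 2 (by omega), h.gram (k + 3) (by omega) 2 (by omega)] at h5
    have e1 : ¬ k + 3 = 2 := by omega
    simp [e1] at h5
    split_ifs at h5 <;> omega
  refine ⟨c', S ⊓ LinearMap.ker (LinearMap.proj e), f, ⟨?_, ?_, ?_, ?_, ?_, hfS, ?_, ?_⟩,
    fun i hi => hlow i (by omega), hself⟩
  · intro i hi j hj
    rw [hdot i hi j hj, hdot i hi i hi, h.gram (i + 1) (by omega) (j + 1) (by omega)]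
    simp only [Nat.add_right_cancel_iff, Nat.add_eq_zero_iff, one_ne_zero, and_false, false_and,
      if_false, sub_zero]
    generalize c (i + 1) ⬝ᵥ c (i + 1) = a
    clear * - hi hj
    by_cases hij : i = j
    · subst hij
      simp only [if_true]
      split_ifs <;> omega
    · simp only [hij, if_false]
      split_ifs <;> omega
  · intro i hi
    by_cases hi2 : i = k + 2
    · subst hi2
      omega
    · rw [hlow i hi2]
      exact h.two_le (i + 1) (by omega)
  · rw [Finset.sum_range_succ, hself, Finset.sum_congr rfl fun i hi => by
      rw [hlow i (Finset.mem_range.1 hi).ne]]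
    push_cast at hsum ⊢
    linarith
  · have := finrank_inf_ker_proj_lt h.single_mem
    have := h.finrank_le
    omega
  · intro i hi
    have hmem : (fun x => (c (i + 1) x : ℚ)) ∈
        S ⊓ LinearMap.ker (LinearMap.proj e : (ι → ℚ) →ₗ[ℚ] ℚ) :=
      ⟨h.mem (i + 1) (by omega), by simp [h.eq_zero (i + 1) (by omega) (by omega)]⟩
    by_cases hi2 : i = k + 2
    · subst hi2
      rw [hlast]
      exact (cast_update_zero_mem hfS hmem).1
    · rw [hlow i hi2]
      exact hmem
  · rw [hlow 0 (by omega), hcf 1 (by omega) (by omega)]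
    simp [hf]
  · intro i hi0 hi
    by_cases hi2 : i = k + 2
    · subst hi2
      simp [hlast]
    · rw [hlow i hi2, hcf (i + 1) (by omega) (by omega), if_neg (by omega), if_neg (by omega)]
      simp

theorem CycData.reverse {k : ℕ} {c : ℕ → ι → ℤ} {S : Submodule ℚ (ι → ℚ)} {e : ι}
    (h : CycData (k + 3) c S e) :
    CycData (k + 3) (fun i => if i = 0 then c 0 else c (k + 3 - i)) S e := by
  have hd : ∀ i < k + 3, ∃ j < k + 3, (if i = 0 then c 0 else c (k + 3 - i)) = c j ∧
      ((i = 0 ∧ j = 0) ∨ (0 < i ∧ 0 < j ∧ i + j = k + 3)) := by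
    intro i hi
    by_cases hi0 : i = 0
    · exact ⟨0, by omega, if_pos hi0, by omega⟩
    · exact ⟨k + 3 - i, by omega, if_neg hi0, by omega⟩
  refine ⟨?_, ?_, ?_, h.finrank_le, ?_, h.single_mem, h.sq_eq_one, ?_⟩
  · intro i hi j hj
    obtain ⟨i', hi', hic, hii⟩ := hd i hi
    obtain ⟨j', hj', hjc, hjj⟩ := hd j hj
    simp only [hic, hjc]
    rw [h.gram i' hi' j' hj']
    generalize c i' ⬝ᵥ c i' = a
    clear * - hii hjj
    have e1 : (i' = j') ↔ (i = j) := by omega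
    have e2 : (j' = i' + 1 ∨ i' = 0 ∧ j' + 1 = k + 3 ∨ i' = j' + 1 ∨ j' = 0 ∧ i' + 1 = k + 3) ↔
        (j = i + 1 ∨ i = 0 ∧ j + 1 = k + 3 ∨ i = j + 1 ∨ j = 0 ∧ i + 1 = k + 3) := by omega
    have key : ∀ i j, ((if j = i + 1 then (1 : ℤ) else 0) + (if i = j + 1 then 1 else 0)
        + (if i = 0 ∧ j + 1 = k + 3 then 1 else 0) + (if j = 0 ∧ i + 1 = k + 3 then 1 else 0))
        = if (j = i + 1 ∨ i = 0 ∧ j + 1 = k + 3 ∨ i = j + 1 ∨ j = 0 ∧ i + 1 = k + 3)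
          then 1 else 0 := by
      intro i j
      split_ifs <;> omega
    have k1 := key i j
    have k2 := key i' j'
    simp only [e1]
    simp only [e2] at k2
    linarith
  · intro i hi
    obtain ⟨i', hi', hic, -⟩ := hd i hi
    simp only [hic]
    exact h.two_le i' hi'
  · have := h.sum_eq
    rw [Finset.sum_range_succ'] at this ⊢
    rw [← Finset.sum_range_reflect] at this
    simp only [if_true, Nat.add_eq_zero_iff, one_ne_zero, and_false, if_false]
    rw [← this]
    congr 1
    refine Finset.sum_congr rfl fun i hi => ?_
    have hi' := Finset.mem_range.1 hi
    have : k + 3 - (i + 1) = k + 2 - 1 - i + 1 := by omega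
    rw [this]
  · intro i hi
    obtain ⟨i', hi', hic, -⟩ := hd i hi
    simp only [hic]
    exact h.mem i' hi'
  · intro i hi0 hi
    obtain ⟨i', hi', hic, hii⟩ := hd i hi
    simp only [hic]
    exact h.eq_zero i' (by omega) hi'

end Contraction

/-- The string of squares of `c 0, …, c (m - 1)` for the negative definite form. -/
def sqString {ι : Type*} [Fintype ι] (m : ℕ) (c : ℕ → ι → ℤ) : List ℤ :=
  (List.range m).map fun i => -(c i ⬝ᵥ c i)

theorem sqString_succ {ι : Type*} [Fintype ι] (m : ℕ) (c : ℕ → ι → ℤ) :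
    sqString (m + 1) c = -(c 0 ⬝ᵥ c 0) :: sqString m fun i => c (i + 1) := by
  simp [sqString, List.range_succ_eq_map, Function.comp_def]

theorem sqString_succ' {ι : Type*} [Fintype ι] (m : ℕ) (c : ℕ → ι → ℤ) :
    sqString (m + 1) c = sqString m c ++ [-(c m ⬝ᵥ c m)] := by
  simp [sqString, List.range_succ]

theorem sqString_congr {ι : Type*} [Fintype ι] {m : ℕ} {c d : ℕ → ι → ℤ}
    (h : ∀ i < m, c i = d i) : sqString m c = sqString m d := by
  refine List.map_congr_left fun i hi => ?_
  rw [h i (List.mem_range.1 hi)]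

theorem sqString_reverse {ι : Type*} [Fintype ι] (m : ℕ) (c : ℕ → ι → ℤ) :
    sqString m (fun i => c (m - (i + 1) + 1)) = (sqString m fun i => c (i + 1)).reverse := by
  refine List.ext_getElem (by simp [sqString]) fun i h1 h2 => ?_
  simp only [sqString, List.getElem_map, List.getElem_range, List.getElem_reverse, List.length_map,
    List.length_range] at *
  have : m - (i + 1) = m - 1 - i := by omega
  rw [this]

theorem CycData.exists_expansion {ι : Type*} [Fintype ι] [DecidableEq ι] (k : ℕ) :
    ∀ {c : ℕ → ι → ℤ} {S : Submodule ℚ (ι → ℚ)} {e : ι}, CycData (k + 3) c S e →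
      ∃ l, Relation.ReflTransGen IsNeg2Expansion [-2, -2, -5] (-2 :: l) ∧
        (sqString (k + 3) c = -2 :: l ∨ sqString (k + 3) c = -2 :: l.reverse) := by
  have wlog_one : ∀ k, (∀ {c : ℕ → ι → ℤ} {S : Submodule ℚ (ι → ℚ)} {e : ι},
      CycData (k + 3) c S e → c 1 ⬝ᵥ c 1 = 2 →
      ∃ l, Relation.ReflTransGen IsNeg2Expansion [-2, -2, -5] (-2 :: l) ∧
        (sqString (k + 3) c = -2 :: l ∨ sqString (k + 3) c = -2 :: l.reverse)) →
      ∀ {c : ℕ → ι → ℤ} {S : Submodule ℚ (ι → ℚ)} {e : ι}, CycData (k + 3) c S e →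
      ∃ l, Relation.ReflTransGen IsNeg2Expansion [-2, -2, -5] (-2 :: l) ∧
        (sqString (k + 3) c = -2 :: l ∨ sqString (k + 3) c = -2 :: l.reverse) := by
    intro k H c S e h
    rcases h.dotProduct_self_one_or (by omega) with h1 | h1
    · exact H h h1
    · obtain ⟨l, hl, hs⟩ := H h.reverse (by simpa using h1)
      rw [sqString_succ] at hs
      have hs' : sqString (k + 2) (fun i => if i + 1 = 0 then c 0 else c (k + 3 - (i + 1))) =
          (sqString (k + 2) fun i => c (i + 1)).reverse := by
        rw [← sqString_reverse]
        refine sqString_congr fun i hi => ?_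
        rw [if_neg (by omega)]
        congr 1
        omega
      rw [hs', if_pos rfl] at hs
      rw [sqString_succ]
      refine ⟨l, hl, ?_⟩
      rcases hs with hs | hs
      · right
        rw [List.cons.injEq] at hs ⊢
        exact ⟨hs.1, by rw [← hs.2, List.reverse_reverse]⟩
      · left
        rw [List.cons.injEq] at hs ⊢
        exact ⟨hs.1, List.reverse_injective hs.2⟩
  induction k with
  | zero =>
    intro c S e
    refine wlog_one 0 fun {c S e} h h1 =>
      ⟨[-2, -5], Relation.ReflTransGen.refl, Or.inl ?_⟩
    have h0 := h.dotProduct_self_zero le_rfl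
    have hsum := h.sum_eq
    simp only [Finset.sum_range_succ, Finset.sum_range_zero, h0, h1] at hsum
    have h2 : c 2 ⬝ᵥ c 2 = 5 := by
      push_cast at hsum
      linarith
    simp [sqString, List.range_succ, h0, h1, h2]
  | succ k ih =>
    intro c S e
    refine wlog_one (k + 1) fun {c S e} h h1 => ?_
    have h0 := h.dotProduct_self_zero (by omega)
    obtain ⟨c', S', f, h', hlow, hlast⟩ := h.exists_contraction h1
    obtain ⟨l, hl, hs⟩ := ih h'
    set A := sqString (k + 1) fun i => c (i + 2) with hA
    have hc' : sqString (k + 3) c' = -2 :: (A ++ [-(c (k + 3) ⬝ᵥ c (k + 3)) + 1]) := by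
      rw [sqString_succ', sqString_congr hlow, sqString_succ, h1, hlast]
      simp only [List.cons_append]
      congr 3
      ring
    have hc : sqString (k + 1 + 3) c =
        -2 :: -2 :: (A ++ [-(c (k + 3) ⬝ᵥ c (k + 3)) + 1 - 1]) := by
      rw [sqString_succ', sqString_succ, sqString_succ, h0, h1]
      simp only [add_sub_cancel_right]
      rfl
    rw [hc'] at hs
    rw [hc]
    generalize -(c (k + 3) ⬝ᵥ c (k + 3)) + 1 = a at hs ⊢
    rcases hs with hs | hs
    · obtain rfl := (List.cons.inj hs).2
      exact ⟨_, hl.tail (IsNeg2Expansion.first A a), Or.inl rfl⟩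
    · have hl' : l = a :: A.reverse := by
        rw [← List.reverse_reverse l, ← (List.cons.inj hs).2]
        simp
      subst hl'
      exact ⟨_, hl.tail (IsNeg2Expansion.second a A.reverse), Or.inr (by simp)⟩

theorem negForm_eq_neg_dotProduct (N : ℕ) (u v : Fin N → ℤ) : negForm N u v = -(u ⬝ᵥ v) := rfl

theorem conn_iff_exists_eqvGen {N : ℕ} {V : Finset (Fin N → ℤ)} {x y : Fin N → ℤ} (hx : x ∈ V) :
    Conn N V x y ↔ ∃ hy : y ∈ V,
      Relation.EqvGen (fun a b : V => a.1 ⬝ᵥ b.1 ≠ 0) ⟨x, hx⟩ ⟨y, hy⟩ := by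
  constructor
  · intro h
    have key : x = y ∨ ∃ (hx : x ∈ V) (hy : y ∈ V),
        Relation.EqvGen (fun a b : V => a.1 ⬝ᵥ b.1 ≠ 0) ⟨x, hx⟩ ⟨y, hy⟩ := by
      clear hx
      induction h with
      | rel a b h =>
        refine Or.inr ⟨h.1, h.2.1, Relation.EqvGen.rel _ _ ?_⟩
        simpa [negForm_eq_neg_dotProduct] using h.2.2
      | refl a => exact Or.inl rfl
      | symm a b _ ih =>
        rcases ih with rfl | ⟨ha, hb, h⟩
        · exact Or.inl rfl
        · exact Or.inr ⟨hb, ha, h.symm _ _⟩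
      | trans a b c _ _ ih1 ih2 =>
        rcases ih1 with rfl | ⟨ha, hb, h⟩
        · exact ih2
        · rcases ih2 with rfl | ⟨hb', hc, h'⟩
          · exact Or.inr ⟨ha, hb, h⟩
          · exact Or.inr ⟨ha, hc, h.trans _ _ _ h'⟩
    rcases key with rfl | ⟨_, hy, h⟩
    · exact ⟨hx, Relation.EqvGen.refl _⟩
    · exact ⟨hy, h⟩
  · rintro ⟨hy, h⟩
    have key : ∀ a b : V, Relation.EqvGen (fun a b : V => a.1 ⬝ᵥ b.1 ≠ 0) a b →
        Conn N V a.1 b.1 := by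
      intro a b h
      induction h with
      | rel a b h =>
        exact Relation.EqvGen.rel _ _ ⟨a.2, b.2, by simpa [negForm_eq_neg_dotProduct] using h⟩
      | refl a => exact Relation.EqvGen.refl _
      | symm a b _ ih => exact ih.symm _ _
      | trans a b c _ _ ih1 ih2 => exact ih1.trans _ _ _ ih2
    exact key _ _ h

theorem mem_compOf {N : ℕ} {V : Finset (Fin N → ℤ)} {u v : Fin N → ℤ} :
    u ∈ compOf N V v ↔ u ∈ V ∧ Conn N V u v := by
  simp [compOf]

/-- The graph of nonzero products of a finite set of vectors. -/
def gramGraph {N : ℕ} (V : Finset (Fin N → ℤ)) : SimpleGraph V where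
  Adj a b := a ≠ b ∧ a.1 ⬝ᵥ b.1 ≠ 0
  symm := ⟨fun a b h => ⟨h.1.symm, by rw [dotProduct_comm]; exact h.2⟩⟩
  loopless := ⟨fun a h => h.1 rfl⟩

theorem gramGraph_reachable_iff {N : ℕ} {V : Finset (Fin N → ℤ)} {a b : V} :
    (gramGraph V).Reachable a b ↔ Conn N V a.1 b.1 := by
  rw [conn_iff_exists_eqvGen a.2]
  constructor
  · rintro ⟨p⟩
    refine ⟨b.2, ?_⟩
    induction p with
    | nil => exact Relation.EqvGen.refl _
    | @cons u v w h _ ih =>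
      have h' : Relation.EqvGen (fun a b : V => a.1 ⬝ᵥ b.1 ≠ 0) u v := Relation.EqvGen.rel u v h.2
      exact h'.trans _ _ _ ih
  · rintro ⟨_, h⟩
    have key : ∀ a b : V, Relation.EqvGen (fun a b : V => a.1 ⬝ᵥ b.1 ≠ 0) a b →
        (gramGraph V).Reachable a b := by
      intro a b h
      induction h with
      | rel a b h =>
        by_cases hab : a = b
        · rw [hab]
        · exact SimpleGraph.Adj.reachable (G := gramGraph V) ⟨hab, h⟩
      | refl a => exact SimpleGraph.Reachable.refl _
      | symm a b _ ih => exact ih.symm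
      | trans a b c _ _ ih1 ih2 => exact ih1.trans ih2
    exact key _ _ h

theorem IsPositive.dotProduct_eq {N : ℕ} {V : Finset (Fin N → ℤ)} (hV : IsPositive N V)
    {u v : Fin N → ℤ} (hu : u ∈ V) (hv : v ∈ V) (huv : u ≠ v) :
    u ⬝ᵥ v = 0 ∨ u ⬝ᵥ v = -1 := by
  have h1 := hV.1.2.1 u hu v hv huv
  have h2 := hV.2 u hu v hv huv
  simp only [negForm_eq_neg_dotProduct] at h1 h2
  omega

theorem IsPositive.filter_card {N : ℕ} {V : Finset (Fin N → ℤ)} (hV : IsPositive N V)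
    {v : Fin N → ℤ} (hv : v ∈ V) : (V.filter fun u => u ≠ v ∧ v ⬝ᵥ u ≠ 0).card = 2 := by
  rw [← hV.1.2.2 v hv]
  congr 1
  refine Finset.filter_congr fun u hu => and_congr_right fun huv => ?_
  have := hV.dotProduct_eq hu hv huv
  rw [dotProduct_comm, negForm_eq_neg_dotProduct]
  omega

theorem IsPositive.sum_dotProduct {N : ℕ} {V : Finset (Fin N → ℤ)} (hV : IsPositive N V)
    {v : Fin N → ℤ} (hv : v ∈ V) : ∑ u ∈ V, v ⬝ᵥ u = v ⬝ᵥ v - 2 := by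
  have h1 : ∀ u ∈ V, v ⬝ᵥ u = (if u = v then v ⬝ᵥ v else 0) -
      (if u ≠ v ∧ v ⬝ᵥ u ≠ 0 then 1 else 0) := by
    intro u hu
    by_cases huv : u = v
    · simp [huv]
    · have := hV.dotProduct_eq hv hu (Ne.symm huv)
      rcases this with h | h <;> simp [huv, h]
  rw [Finset.sum_congr rfl h1, Finset.sum_sub_distrib, Finset.sum_ite_eq', if_pos hv,
    Finset.sum_boole, hV.filter_card hv]
  rfl

theorem IsPositive.exists_cycGram {N : ℕ} {V : Finset (Fin N → ℤ)} (hV : IsPositive N V)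
    {v : Fin N → ℤ} (hv : v ∈ V) :
    ∃ (m : ℕ) (c : ℕ → Fin N → ℤ), 3 ≤ m ∧ c 0 = v ∧ Set.InjOn c {i | i < m} ∧
      (∀ u, u ∈ compOf N V v ↔ ∃ i < m, c i = u) ∧ CycGram m c := by
  have hcyc : (gramGraph V).IsCycles := by
    intro a _
    have : Subtype.val '' (gramGraph V).neighborSet a =
        (V.filter fun u => u ≠ a.1 ∧ a.1 ⬝ᵥ u ≠ 0 : Finset (Fin N → ℤ)) := by
      ext u
      simp only [Set.mem_image, SimpleGraph.mem_neighborSet, gramGraph, Subtype.exists,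
        Finset.coe_filter, Set.mem_ofPred_eq]
      constructor
      · rintro ⟨x, hx, h, rfl⟩
        exact ⟨hx, fun h' => h.1 (Subtype.ext h'.symm), h.2⟩
      · rintro ⟨hu, hne, h⟩
        exact ⟨u, hu, ⟨fun h' => hne (congrArg Subtype.val h').symm, h⟩, rfl⟩
    rw [← Set.ncard_image_of_injective _ Subtype.val_injective, this, Set.ncard_coe_finset,
      hV.filter_card a.2]
  have hne : ((gramGraph V).neighborSet ⟨v, hv⟩).Nonempty := by
    have h2 := hV.filter_card hv
    obtain ⟨u, hu⟩ := Finset.card_pos.1 (h2.symm ▸ two_pos :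
      0 < (V.filter fun u => u ≠ v ∧ v ⬝ᵥ u ≠ 0).card)
    rw [Finset.mem_filter] at hu
    exact ⟨⟨u, hu.1⟩, fun h => hu.2.1 (congrArg Subtype.val h).symm, hu.2.2⟩
  obtain ⟨p, hp, hverts⟩ := hcyc.exists_cycle_toSubgraph_verts_eq_connectedComponentSupp
    (SimpleGraph.ConnectedComponent.connectedComponentMk_mem (v := (⟨v, hv⟩ : V))) hne
  have h3 := hp.three_le_length
  set m := p.length with hm
  set c : ℕ → Fin N → ℤ := fun i => (p.getVert i).1 with hc
  have hcV : ∀ i, c i ∈ V := fun i => (p.getVert i).2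
  have hinj : ∀ i < m, ∀ j < m, c i = c j → i = j := by
    intro i hi j hj hij
    exact hp.getVert_injOn' (by simp; omega) (by simp; omega) (Subtype.ext hij)
  have hcm : c m = c 0 := by simp [hc, hm]
  have hadj : ∀ i < m, c i ⬝ᵥ c (i + 1) ≠ 0 := fun i hi => (p.adj_getVert_succ hi).2
  have hmem : ∀ u, u ∈ compOf N V v ↔ ∃ i < m, c i = u := by
    intro u
    rw [mem_compOf]
    have key : ∀ a : V, (gramGraph V).Reachable a ⟨v, hv⟩ ↔ a ∈ p.support := by
      intro a
      rw [← SimpleGraph.Walk.mem_verts_toSubgraph, hverts,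
        SimpleGraph.ConnectedComponent.mem_supp_iff, SimpleGraph.ConnectedComponent.eq]
    constructor
    · rintro ⟨hu, h⟩
      have := (key ⟨u, hu⟩).1 (gramGraph_reachable_iff.2 h)
      obtain ⟨n, hn, hnm⟩ := SimpleGraph.Walk.mem_support_iff_exists_getVert.1 this
      rcases hnm.lt_or_eq with hlt | heq
      · exact ⟨n, hlt, congrArg Subtype.val hn⟩
      · refine ⟨0, by omega, ?_⟩
        rw [← hcm, hm, ← heq]
        exact congrArg Subtype.val hn
    · rintro ⟨i, hi, rfl⟩
      exact ⟨hcV i, gramGraph_reachable_iff.1 ((key _).2 (p.getVert_mem_support i))⟩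
  have hnext : ∀ i < m, ∃ j < m, c i ⬝ᵥ c j ≠ 0 ∧ (j = i + 1 ∨ j = 0 ∧ i + 1 = m) := by
    intro i hi
    by_cases him : i + 1 = m
    · refine ⟨0, by omega, ?_, by omega⟩
      rw [← hcm, ← him]
      exact hadj i hi
    · exact ⟨i + 1, by omega, hadj i hi, by omega⟩
  have hprev : ∀ i < m, ∃ j < m, c i ⬝ᵥ c j ≠ 0 ∧ (i = j + 1 ∨ i = 0 ∧ j + 1 = m) := by
    intro i hi
    rcases Nat.eq_zero_or_pos i with hi0 | hi0
    · refine ⟨m - 1, by omega, ?_, by omega⟩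
      have := hadj (m - 1) (by omega)
      rw [Nat.sub_add_cancel (by omega), hcm] at this
      rwa [hi0, dotProduct_comm]
    · refine ⟨i - 1, by omega, ?_, by omega⟩
      have := hadj (i - 1) (by omega)
      rw [Nat.sub_add_cancel (by omega)] at this
      rwa [dotProduct_comm]
  refine ⟨m, c, h3, by simp [hc], fun i hi j hj h => hinj i hi j hj h, hmem, ?_⟩
  intro i hi j hj
  by_cases hij : i = j
  · subst hij
    have e1 : ¬ (i = 0 ∧ i + 1 = m) := by omega
    simp [e1]
  · obtain ⟨a, ha, ha0, ha'⟩ := hnext i hi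
    obtain ⟨b, hb, hb0, hb'⟩ := hprev i hi
    have hsub : ({c a, c b} : Finset (Fin N → ℤ)) ⊆
        V.filter fun u => u ≠ c i ∧ c i ⬝ᵥ u ≠ 0 := by
      intro u hu
      rw [Finset.mem_insert, Finset.mem_singleton] at hu
      rw [Finset.mem_filter]
      rcases hu with rfl | rfl
      · exact ⟨hcV a, fun h => by have := hinj _ ha _ hi h; omega, ha0⟩
      · exact ⟨hcV b, fun h => by have := hinj _ hb _ hi h; omega, hb0⟩
    have hab : c a ≠ c b := fun h => by
      have := hinj _ ha _ hb h
      omega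
    have heq := Finset.eq_of_subset_of_card_le hsub
      (by rw [hV.filter_card (hcV i), Finset.card_pair hab])
    have hiff : c i ⬝ᵥ c j ≠ 0 ↔ j = a ∨ j = b := by
      constructor
      · intro h
        have : c j ∈ ({c a, c b} : Finset (Fin N → ℤ)) := by
          rw [heq, Finset.mem_filter]
          exact ⟨hcV j, fun h' => hij (hinj _ hj _ hi h').symm, h⟩
        rw [Finset.mem_insert, Finset.mem_singleton] at this
        exact this.imp (hinj _ hj _ ha) (hinj _ hj _ hb)
      · rintro (rfl | rfl) <;> assumption
    have hval := hV.dotProduct_eq (hcV i) (hcV j) fun h => hij (hinj _ hi _ hj h)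
    generalize c i ⬝ᵥ c j = x at *
    clear * - hval hiff ha hb ha' hb' hij hi hj h3
    rw [if_neg hij]
    by_cases hx : j = a ∨ j = b
    · have : x = -1 := hval.resolve_left (hiff.2 hx)
      subst this
      split_ifs <;> omega
    · have : x = 0 := not_not.1 (mt hiff.1 hx)
      subst this
      split_ifs <;> omega

theorem IsCanonicalBasis.sum_apply_sq {N : ℕ} {E : Finset (Fin N → ℤ)}
    (hE : IsCanonicalBasis N E) (i : Fin N) : (∑ e ∈ E, e) i ^ 2 = 1 := by
  obtain ⟨hcard, hself, horth⟩ := hE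
  have hex : ∀ e : E, ∃ j, e.1 j ^ 2 = 1 ∧ ∀ i ≠ j, e.1 i = 0 := by
    rintro ⟨e, he⟩
    have h1 : ∑ i, e i * e i = 1 := by
      have := hself e he
      simp only [negForm] at this
      linarith
    obtain ⟨j, _, hj⟩ := Finset.exists_ne_zero_of_sum_ne_zero (h1.symm ▸ one_ne_zero)
    have h2 := Finset.add_sum_erase Finset.univ (fun i => e i * e i) (Finset.mem_univ j)
    have h3 : ∀ i ∈ Finset.univ.erase j, 0 ≤ e i * e i := fun i _ => mul_self_nonneg _
    have h4 := Finset.sum_nonneg h3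
    have h5 : 0 < e j * e j := lt_of_le_of_ne (mul_self_nonneg _) hj.symm
    have h6 : ∑ i ∈ Finset.univ.erase j, e i * e i = 0 := by linarith
    refine ⟨j, by nlinarith, fun i hi => ?_⟩
    exact mul_self_eq_zero.1
      ((Finset.sum_eq_zero_iff_of_nonneg h3).1 h6 i (Finset.mem_erase.2 ⟨hi, Finset.mem_univ _⟩))
  choose f hf hf0 using hex
  have hinj : Function.Injective f := by
    intro a b hab
    by_contra hne
    have h1 := horth a.1 a.2 b.1 b.2 fun h => hne (Subtype.ext h)
    rw [negForm, Finset.sum_eq_single (f a)] at h1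
    · have h2 := hf a
      have h3 := hf b
      rw [← hab] at h3
      have h4 : a.1 (f a) * b.1 (f a) = 0 := by linarith
      rcases mul_eq_zero.1 h4 with h | h <;> simp [h] at h2 h3
    · intro i _ hi
      rw [hf0 a i hi, zero_mul]
    · simp
  have hsurj : Function.Surjective f :=
    ((Fintype.bijective_iff_injective_and_card f).2 ⟨hinj, by simp [hcard]⟩).2
  obtain ⟨e, rfl⟩ := hsurj i
  rw [Finset.sum_apply, Finset.sum_eq_single e.1]
  · exact hf e
  · intro b hb hbe
    refine hf0 ⟨b, hb⟩ _ fun h => hbe ?_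
    exact (congrArg Subtype.val (hinj h)).symm
  · exact fun h => absurd e.2 h

theorem IsCanonicalBasis.exists_dotProduct_eq {N : ℕ} {E : Finset (Fin N → ℤ)}
    (hE : IsCanonicalBasis N E) {e : Fin N → ℤ} (he : e ∈ E) :
    ∃ i, ∀ x : Fin N → ℤ, x ⬝ᵥ e = (∑ f ∈ E, f) i * x i := by
  have h1 : e ⬝ᵥ (∑ f ∈ E, f) = 1 := by
    rw [dotProduct_sum, Finset.sum_eq_single e]
    · have := hE.2.1 e he
      rw [negForm_eq_neg_dotProduct] at this
      linarith
    · intro f hf hfe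
      have := hE.2.2 e he f hf hfe.symm
      rw [negForm_eq_neg_dotProduct] at this
      linarith
    · exact fun h => absurd he h
  have h2 : e ⬝ᵥ e = 1 := by
    have := hE.2.1 e he
    rw [negForm_eq_neg_dotProduct] at this
    linarith
  set W := ∑ f ∈ E, f with hW
  have hW2 := hE.sum_apply_sq
  rw [← hW] at hW2
  obtain ⟨i, _, hi⟩ := Finset.exists_ne_zero_of_sum_ne_zero
    (show ∑ i, e i * e i ≠ 0 from fun h => by rw [dotProduct] at h2; omega)
  have hi1 : 1 ≤ e i * e i := lt_of_le_of_ne (mul_self_nonneg _) (Ne.symm hi)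
  have hsplit := Finset.add_sum_erase Finset.univ (fun i => e i * e i) (Finset.mem_univ i)
  have hnn : ∀ j ∈ Finset.univ.erase i, 0 ≤ e j * e j := fun j _ => mul_self_nonneg _
  have hz : ∑ j ∈ Finset.univ.erase i, e j * e j = 0 := by
    have := Finset.sum_nonneg hnn
    rw [dotProduct] at h2
    linarith
  have hz' : ∀ j, j ≠ i → e j = 0 := fun j hj => mul_self_eq_zero.1
    ((Finset.sum_eq_zero_iff_of_nonneg hnn).1 hz j (Finset.mem_erase.2 ⟨hj, Finset.mem_univ _⟩))
  have hdot : ∀ x : Fin N → ℤ, x ⬝ᵥ e = x i * e i := by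
    intro x
    rw [dotProduct, Finset.sum_eq_single i]
    · intro j _ hj
      rw [hz' j hj, mul_zero]
    · simp
  refine ⟨i, fun x => ?_⟩
  have h3 : W i * e i = 1 := by rw [← hdot, dotProduct_comm, h1]
  rw [hdot]
  linear_combination x i * W i * h3 - x i * e i * hW2 i

/-- If two vectors have the same coefficient, then some coordinate occurs in exactly one
vector. -/
theorem exists_coordinate_of_not_injective {N : ℕ} {V : Finset (Fin N → ℤ)}
    (hcard : V.card = N) (hW : ∀ i, (∑ v ∈ V, v) i ^ 2 = 1)
    (hrow : ∀ v ∈ V, v ⬝ᵥ (∑ u ∈ V, u) = v ⬝ᵥ v - 2) {v v' : Fin N → ℤ} (hv : v ∈ V)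
    (hv' : v' ∈ V) (hne : v ≠ v') {i : Fin N}
    (hvi : 2 ≤ v i ^ 2 - (∑ u ∈ V, u) i * v i) (hvi' : 2 ≤ v' i ^ 2 - (∑ u ∈ V, u) i * v' i) :
    ∃ e, ∃ v ∈ V, v e ^ 2 = 1 ∧ ∀ u ∈ V, u ≠ v → u e = 0 := by
  have hsumapp : ∀ i, ∑ u ∈ V, u i = (∑ u ∈ V, u) i := fun i => (Finset.sum_apply i V _).symm
  set W := ∑ u ∈ V, u with hWdef
  have hW' : ∀ i, W i = 1 ∨ W i = -1 := fun i => 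
    mul_self_eq_one_iff.1 (by rw [← sq]; exact hW i)
  have hq : ∀ (u : Fin N → ℤ) i, 0 ≤ u i ^ 2 - W i * u i := by
    intro u i
    rcases hW' i with h | h <;> rw [h] <;> rcases le_or_gt (u i) 0 with h' | h' <;> nlinarith
  have htot : ∑ i, ∑ u ∈ V, (u i ^ 2 - W i * u i) = ∑ _i : Fin N, 2 := by
    rw [Finset.sum_comm, Finset.sum_congr rfl (g := fun _ => (2 : ℤ))]
    · simp [hcard]
    · intro u hu
      have := hrow u hu
      simp only [dotProduct] at this
      rw [Finset.sum_sub_distrib]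
      simp only [sq, mul_comm (W _)]
      linarith
  have hcol : ∃ j, ∀ u ∈ V, u j ^ 2 - W j * u j < 2 := by
    by_contra! hcon
    refine htot.not_gt (Finset.sum_lt_sum (fun j _ => ?_) ⟨i, Finset.mem_univ _, ?_⟩)
    · obtain ⟨u, hu, h⟩ := hcon j
      exact h.trans (Finset.single_le_sum (f := fun u : Fin N → ℤ => u j ^ 2 - W j * u j)
        (fun u _ => hq u j) hu)
    · have := Finset.sum_le_sum_of_subset_of_nonneg
        (f := fun u : Fin N → ℤ => u i ^ 2 - W i * u i) (s := {v, v'}) (t := V)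
        (by simp [Finset.insert_subset_iff, hv, hv']) (fun u _ _ => hq u i)
      rw [Finset.sum_pair hne] at this
      linarith
  obtain ⟨j, hj⟩ := hcol
  have hsq : ∀ u ∈ V, u j ^ 2 = W j * u j := by
    intro u hu
    have h1 := hj u hu
    have h2 := hq u j
    have h3 : (u j ^ 2 - W j * u j) % 2 = 0 := by
      rcases hW' j with h | h <;> rw [h] <;>
        rcases Int.even_or_odd' (u j) with ⟨k, hk | hk⟩ <;> rw [hk] <;> ring_nf <;> omega
    omega
  have hone : ∑ u ∈ V, u j ^ 2 = 1 := by
    rw [Finset.sum_congr rfl hsq, ← Finset.mul_sum, hsumapp, ← sq, hW]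
  obtain ⟨u, hu, hu0⟩ := Finset.exists_ne_zero_of_sum_ne_zero (hone.symm ▸ one_ne_zero)
  have h1 := Finset.add_sum_erase V (fun u : Fin N → ℤ => u j ^ 2) hu
  have hnn : ∀ x ∈ V.erase u, 0 ≤ x j ^ 2 := fun x _ => sq_nonneg _
  have h2 := Finset.sum_nonneg hnn
  have h3 : 0 < u j ^ 2 := lt_of_le_of_ne (sq_nonneg _) hu0.symm
  have h4 : ∑ x ∈ V.erase u, x j ^ 2 = 0 := by linarith
  refine ⟨j, u, hu, by linarith, fun x hx hxu => ?_⟩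
  exact pow_eq_zero_iff two_ne_zero |>.1
    ((Finset.sum_eq_zero_iff_of_nonneg hnn).1 h4 x (Finset.mem_erase.2 ⟨hxu, hx⟩))

theorem sum_add_two_eq_neg_card {N : ℕ} {V : Finset (Fin N → ℤ)}
    (hcomp : ∀ v ∈ V,
      (∑ u ∈ compOf N V v, (negForm N u u + 2)) = -((compOf N V v).card : ℤ)) :
    ∑ v ∈ V, (negForm N v v + 2) = -(V.card : ℤ) := by
  classical
  have hfib : ∀ v ∈ V, (V.filter fun u => compOf N V u = compOf N V v) = compOf N V v := by
    intro v hv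
    ext u
    rw [Finset.mem_filter, mem_compOf]
    refine and_congr_right fun hu => ⟨fun h => ?_, fun h => ?_⟩
    · exact (mem_compOf.1 (h ▸ mem_compOf.2 ⟨hu, Relation.EqvGen.refl u⟩)).2
    · ext x
      rw [mem_compOf, mem_compOf]
      exact and_congr_right fun _ =>
        ⟨fun h' => h'.trans _ _ _ h, fun h' => h'.trans _ _ _ (h.symm _ _)⟩
  have hzero : ∑ v ∈ V, (negForm N v v + 2 + 1) = 0 := by
    rw [← Finset.sum_fiberwise_of_maps_to (t := V.image (compOf N V)) (g := compOf N V)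
      fun v hv => Finset.mem_image_of_mem _ hv]
    refine Finset.sum_eq_zero fun C hC => ?_
    obtain ⟨v, hv, rfl⟩ := Finset.mem_image.1 hC
    rw [hfib v hv, Finset.sum_add_distrib, hcomp v hv]
    simp
  rw [Finset.sum_add_distrib] at hzero
  simp at hzero ⊢
  linarith

theorem IsPositive.linearIndependent {N : ℕ} {V : Finset (Fin N → ℤ)} (hV : IsPositive N V)
    (hsq : ∀ v ∈ V, negForm N v v ≤ -2)
    (hcomp : ∀ v ∈ V,
      (∑ u ∈ compOf N V v, (negForm N u u + 2)) = -((compOf N V v).card : ℤ)) :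
    LinearIndependent ℚ (fun (v : V) i => (v.1 i : ℚ)) := by
  have hrow : ∀ v : V, ∑ u : V, v.1 ⬝ᵥ u.1 = v.1 ⬝ᵥ v.1 - 2 := by
    intro v
    rw [← hV.sum_dotProduct v.2, ← Finset.sum_coe_sort V]
  refine linearIndependent_of_gram (fun v : V => v.1) ?_ ?_ ?_
  · intro u v huv
    have := hV.dotProduct_eq u.2 v.2 fun h => huv (Subtype.ext h)
    omega
  · intro v
    have := hsq v.1 v.2
    rw [negForm_eq_neg_dotProduct] at this
    rw [hrow]
    linarith
  · intro v
    have h1 : ∑ u ∈ compOf N V v, (negForm N u u + 2) < 0 := by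
      rw [hcomp v.1 v.2]
      have := hV.1.1 v.1 v.2
      omega
    obtain ⟨u, hu, hu0⟩ : ∃ u ∈ compOf N V v, negForm N u u + 2 < 0 := by
      by_contra! hcon
      exact h1.not_ge (Finset.sum_nonneg hcon)
    obtain ⟨huV, hconn⟩ := mem_compOf.1 hu
    obtain ⟨_, hconn'⟩ := (conn_iff_exists_eqvGen huV).1 hconn
    refine ⟨⟨u, huV⟩, hconn'.symm _ _, ?_⟩
    rw [negForm_eq_neg_dotProduct] at hu0
    rw [hrow]
    simp only
    linarith

theorem finrank_ker_mulVecLin_le {N : ℕ} {V C : Finset (Fin N → ℤ)} (hC : C ⊆ V)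
    (hcard : V.card = N) (hli : LinearIndependent ℚ (fun (v : V) i => (v.1 i : ℚ))) :
    Module.finrank ℚ (LinearMap.ker (Matrix.mulVecLin
      (Matrix.of fun (v : ↥(V \ C)) i => (v.1 i : ℚ)))) ≤ C.card := by
  set M := Matrix.of fun (v : ↥(V \ C)) i => (v.1 i : ℚ) with hM
  have hli' : LinearIndependent ℚ M.row :=
    hli.comp (fun v : ↥(V \ C) => (⟨v.1, (Finset.mem_sdiff.1 v.2).1⟩ : V))
      fun a b h => Subtype.ext (congrArg (fun x : V => x.1) h)
  have h1 : M.rank = (V \ C).card := by simpa using hli'.rank_matrix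
  have h2 := LinearMap.finrank_range_add_finrank_ker M.mulVecLin
  rw [← Matrix.rank, h1, Module.finrank_fin_fun] at h2
  have h3 := Finset.card_sdiff_add_card_eq_card hC
  omega

/-- Proposition on positive circular subsets, non-injective case:
under the stated assumptions there is a connected component of `V` whose string
of self-intersections is obtained, up to circular symmetry, from `(-2,-2,-5)` by
a finite sequence of `(-2)`-expansions. -/
theorem stmt_3 (N : ℕ) (V E : Finset (Fin N → ℤ))
    (hpos : IsPositive N V)
    (hsq : ∀ v ∈ V, negForm N v v ≤ -2)
    (hodd : Odd (AddSubgroup.closure (V : Set (Fin N → ℤ))).index)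
    (hW : negForm N (∑ v ∈ V, v) (∑ v ∈ V, v) = -(N : ℤ))
    (hE : IsAdaptedBasis N E V)
    (hninj : ∃ v ∈ V, ∃ v' ∈ V, v ≠ v' ∧ ∃ e ∈ E,
      (negForm N v e = -1 ∨ negForm N v e = 2) ∧
      (negForm N v' e = -1 ∨ negForm N v' e = 2))
    (hcomp : ∀ v ∈ V,
      (∑ u ∈ compOf N V v, (negForm N u u + 2)) = -((compOf N V v).card : ℤ)) :
    ∃ v₀ ∈ V, ∃ (m : ℕ) (w : ZMod m → (Fin N → ℤ)),
      IsCyclicListing N (compOf N V v₀) m w ∧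
      ∃ S₀ : List ℤ, Relation.ReflTransGen IsNeg2Expansion [-2, -2, -5] S₀ ∧
        ∃ r : ℕ,
          (List.ofFn fun i : Fin m =>
            negForm N (w ((i : ℕ) : ZMod m)) (w ((i : ℕ) : ZMod m))) = S₀.rotate r ∨
          (List.ofFn fun i : Fin m =>
            negForm N (w ((i : ℕ) : ZMod m)) (w ((i : ℕ) : ZMod m))) =
            (S₀.rotate r).reverse := by
  have hW2 : ∀ i, (∑ v ∈ V, v) i ^ 2 = 1 := by
    intro i
    rw [hE.2, Pi.neg_apply, neg_sq]
    exact hE.1.sum_apply_sq i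
  have hrow : ∀ v ∈ V, v ⬝ᵥ (∑ u ∈ V, u) = v ⬝ᵥ v - 2 := by
    intro v hv
    rw [dotProduct_sum]
    exact hpos.sum_dotProduct hv
  have hcard : V.card = N := by
    have h1 : ∑ v ∈ V, v ⬝ᵥ (∑ u ∈ V, u) = N := by
      rw [← sum_dotProduct]
      rw [negForm_eq_neg_dotProduct] at hW
      linarith
    have h2 := sum_add_two_eq_neg_card hcomp
    rw [Finset.sum_congr rfl fun v hv => hrow v hv] at h1
    have h3 : ∑ v ∈ V, (negForm N v v + 2) = -∑ v ∈ V, (v ⬝ᵥ v - 2) := by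
      rw [← Finset.sum_neg_distrib]
      refine Finset.sum_congr rfl fun v _ => ?_
      rw [negForm_eq_neg_dotProduct]
      ring
    rw [h3, h1] at h2
    omega
  obtain ⟨e, v, hv, hve, huniq⟩ : ∃ e, ∃ v ∈ V, v e ^ 2 = 1 ∧ ∀ u ∈ V, u ≠ v → u e = 0 := by
    obtain ⟨v, hv, v', hv', hne, e, he, h1, h2⟩ := hninj
    obtain ⟨i, hi⟩ := hE.1.exists_dotProduct_eq he
    have hWi : (∑ f ∈ E, f) i = -(∑ u ∈ V, u) i := by rw [hE.2, Pi.neg_apply, neg_neg]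
    have hbound : ∀ x : Fin N → ℤ, (negForm N x e = -1 ∨ negForm N x e = 2) →
        2 ≤ x i ^ 2 - (∑ u ∈ V, u) i * x i := by
      intro x hx
      rw [negForm_eq_neg_dotProduct, hi, hWi] at hx
      have h3 : x i ^ 2 = ((∑ u ∈ V, u) i * x i) ^ 2 := by rw [mul_pow, hW2, one_mul]
      rw [h3]
      have h4 : (∑ u ∈ V, u) i * x i = -1 ∨ (∑ u ∈ V, u) i * x i = 2 := by
        rcases hx with hx | hx
        · left; linarith
        · right; linarith
      rcases h4 with h4 | h4 <;> rw [h4] <;> norm_num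
    exact exists_coordinate_of_not_injective hcard hW2 hrow hv hv' hne (hbound v h1) (hbound v' h2)
  obtain ⟨m, c, hm, hc0, hinj, hmem, hgram⟩ := hpos.exists_cycGram hv
  have hcC : ∀ i < m, c i ∈ compOf N V v := fun i hi => (hmem _).2 ⟨i, hi, rfl⟩
  have hcV : ∀ i < m, c i ∈ V := fun i hi => (mem_compOf.1 (hcC i hi)).1
  have hCimage : compOf N V v = (Finset.range m).image c := by
    ext u
    simp [hmem]
  have hCcard : (compOf N V v).card = m := by
    rw [hCimage, Finset.card_image_of_injOn (by simpa [Set.InjOn] using hinj), Finset.card_range]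
  have hCV : compOf N V v ⊆ V := fun u hu => (mem_compOf.1 hu).1
  have hdata : CycData m c (LinearMap.ker (Matrix.mulVecLin
      (Matrix.of fun (v : ↥(V \ compOf N V v)) i => (v.1 i : ℚ)))) e := by
    refine ⟨hgram, ?_, ?_, ?_, ?_, ?_, ?_, ?_⟩
    · intro i hi
      have := hsq _ (hcV i hi)
      rw [negForm_eq_neg_dotProduct] at this
      linarith
    · have h1 := hcomp v hv
      rw [hCcard, hCimage, Finset.sum_image (by simpa [Set.InjOn] using hinj)] at h1
      rw [← neg_inj, ← h1, ← Finset.sum_neg_distrib]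
      refine Finset.sum_congr rfl fun i _ => ?_
      rw [negForm_eq_neg_dotProduct]
      ring
    · have := finrank_ker_mulVecLin_le hCV hcard (hpos.linearIndependent hsq hcomp)
      rwa [hCcard] at this
    · intro i hi
      rw [LinearMap.mem_ker]
      ext ⟨r, hr⟩
      rw [Finset.mem_sdiff] at hr
      have h0 : r ⬝ᵥ c i = 0 := by
        by_contra hne
        refine hr.2 (mem_compOf.2 ⟨hr.1, ?_⟩)
        refine Relation.EqvGen.trans _ _ _ (Relation.EqvGen.rel _ _ ⟨hr.1, hcV i hi, ?_⟩)
          (mem_compOf.1 (hcC i hi)).2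
        rw [negForm_eq_neg_dotProduct]
        exact neg_ne_zero.2 hne
      simp only [Matrix.mulVecLin_apply, Matrix.mulVec, Matrix.of_apply, dotProduct,
        Pi.zero_apply] at h0 ⊢
      exact_mod_cast h0
    · rw [LinearMap.mem_ker]
      ext ⟨r, hr⟩
      rw [Finset.mem_sdiff] at hr
      have h0 : r e = 0 := huniq r hr.1 fun h =>
        hr.2 (by rw [h]; exact mem_compOf.2 ⟨hv, Relation.EqvGen.refl v⟩)
      simp [h0]
    · rw [hc0, hve]
    · intro i hi0 hi
      refine huniq _ (hcV i hi) fun h => ?_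
      rw [← hc0] at h
      exact hi0.ne' (hinj hi (show 0 < m by omega) h)
  obtain ⟨k, rfl⟩ : ∃ k, m = k + 3 := ⟨m - 3, by omega⟩
  obtain ⟨l, hl, hs⟩ := CycData.exists_expansion k hdata
  have hstring : (List.ofFn fun i : Fin (k + 3) =>
      negForm N (c ((i : ℕ) : ZMod (k + 3)).val) (c ((i : ℕ) : ZMod (k + 3)).val)) =
      sqString (k + 3) c := by
    refine List.ext_getElem (by simp [sqString]) fun i h1 h2 => ?_
    simp only [List.length_ofFn] at h1
    simp only [sqString, List.getElem_ofFn, List.getElem_map, List.getElem_range,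
      ZMod.val_natCast, Nat.mod_eq_of_lt h1, negForm_eq_neg_dotProduct]
  refine ⟨v, hv, k + 3, fun i => c i.val, ⟨hCcard, ?_, fun i => hcC _ (ZMod.val_lt i), ?_, ?_⟩,
    -2 :: l, hl, ?_⟩
  · intro i j hij
    exact ZMod.val_injective _ (hinj (ZMod.val_lt i) (ZMod.val_lt j) hij)
  · intro u hu
    obtain ⟨i, hi, rfl⟩ := (hmem u).1 hu
    exact ⟨(i : ZMod (k + 3)), by simp [ZMod.val_natCast, Nat.mod_eq_of_lt hi]⟩
  · intro i
    left
    have hi := ZMod.val_lt i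
    have h1 : (i + 1).val = if i.val + 1 = k + 3 then 0 else i.val + 1 := by
      rw [ZMod.val_add, ZMod.val_one'' (by omega)]
      split_ifs with h
      · rw [h, Nat.mod_self]
      · exact Nat.mod_eq_of_lt (by omega)
    have hi1 := ZMod.val_lt (i + 1)
    rw [negForm_eq_neg_dotProduct, hgram _ hi _ hi1]
    generalize (i + 1).val = j at *
    by_cases h : i.val + 1 = k + 3
    · rw [if_pos h] at h1
      split_ifs <;> omega
    · rw [if_neg h] at h1
      split_ifs <;> omega
  · rw [hstring]
    rcases hs with hs | hs
    · exact ⟨0, Or.inl (by rw [hs, List.rotate_zero])⟩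
    · exact ⟨1, Or.inr (by rw [hs]; simp)⟩
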